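/- Let P be a finite partial IP loop with #P ≡ 2 or #P ≡ 4 (mod 6). Then there exists a finite partial IP loop Q extending P (a Steiner triplication of P) such that #Q = 3·#P − 2, Γ(Q) = Γ(P) (i.e., every pair (u,v) with u or v outside P lies in D(Q), and the gaps of Q are exactly the gaps of P), and every element of Q \ P belongs to O₂(Q). -/

import Mathlib

/-- A partial IP loop: a set `carrier` with a partial binary operation defined on
a domain `dom ⊆ carrier ×ˢ carrier` (the value of `mul` is only meaningful on `dom`),
with a unit, unique two-sided inverses, and the inverse property. -/
structure PartialIPLoop (α : Type*) where
  carrier : Set α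
  one : α
  dom : Set (α × α)
  mul : α → α → α
  inv : α → α
  one_mem : one ∈ carrier
  dom_subset : dom ⊆ carrier ×ˢ carrier
  mul_mem : ∀ x y, (x, y) ∈ dom → mul x y ∈ carrier
  one_mul_dom : ∀ x ∈ carrier, (one, x) ∈ dom
  mul_one_dom : ∀ x ∈ carrier, (x, one) ∈ dom
  one_mul : ∀ x ∈ carrier, mul one x = x
  mul_one : ∀ x ∈ carrier, mul x one = x
  inv_mem : ∀ x ∈ carrier, inv x ∈ carrier
  mul_inv_dom : ∀ x ∈ carrier, (x, inv x) ∈ dom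
  inv_mul_dom : ∀ x ∈ carrier, (inv x, x) ∈ dom
  mul_inv : ∀ x ∈ carrier, mul x (inv x) = one
  inv_mul : ∀ x ∈ carrier, mul (inv x) x = one
  inv_unique : ∀ x ∈ carrier, ∀ y ∈ carrier,
    (x, y) ∈ dom → (y, x) ∈ dom → mul x y = one → mul y x = one → y = inv x
  ip_left_dom : ∀ x y, (x, y) ∈ dom → (inv x, mul x y) ∈ dom
  ip_right_dom : ∀ x y, (x, y) ∈ dom → (mul x y, inv y) ∈ dom
  ip_left : ∀ x y, (x, y) ∈ dom → mul (inv x) (mul x y) = y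
  ip_right : ∀ x y, (x, y) ∈ dom → mul (mul x y) (inv y) = x

namespace PartialIPLoop

variable {α : Type*}

/-- The set of gaps `Γ(P) = (P × P) \ D(P)`. -/
def gaps (P : PartialIPLoop α) : Set (α × α) :=
  (P.carrier ×ˢ P.carrier) \ P.dom

/-- The set `O₂(P)` of elements of order two. -/
def O2 (P : PartialIPLoop α) : Set α :=
  {x ∈ P.carrier | x ≠ P.one ∧ (x, x) ∈ P.dom ∧ P.mul x x = P.one}

/-- The set `O₃(P)` of elements of order three. -/
def O3 (P : PartialIPLoop α) : Set α :=
  {x ∈ P.carrier | x ≠ P.one ∧ (x, x) ∈ P.dom ∧ (x, P.mul x x) ∈ P.dom ∧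
    P.mul x (P.mul x x) = P.one}

/-- `Q` is an extension of `P`: `P ⊆ Q`, `D(P) ⊆ D(Q)`, and the operations
agree on `D(P)`. -/
def Ext (P Q : PartialIPLoop α) : Prop :=
  P.carrier ⊆ Q.carrier ∧ P.dom ⊆ Q.dom ∧
    ∀ x y, (x, y) ∈ P.dom → P.mul x y = Q.mul x y

end PartialIPLoop

/-- An idempotent totally symmetric quasigroup; equivalently, a Steiner triple system. -/
structure SteinerQuasigroup (G : Type*) where
  op : G → G → G
  op_self : ∀ x, op x x = x
  op_comm : ∀ x y, op x y = op y x
  op_op : ∀ x y, op x (op x y) = y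

namespace SteinerQuasigroup

/-- Transport a Steiner quasigroup along a bijection. -/
def congr {G H : Type*} (s : SteinerQuasigroup G) (e : G ≃ H) : SteinerQuasigroup H where
  op x y := e (s.op (e.symm x) (e.symm y))
  op_self x := by simp [s.op_self]
  op_comm x y := by rw [s.op_comm]
  op_op x y := by simp [s.op_op]

/-- The Bose construction, from an idempotent commutative quasigroup. -/
theorem nonempty_bose {S : Type*} (c d : S → S → S) (hc : ∀ x y, c x y = c y x)
    (hcd : ∀ x y, c x (d x y) = y) (hdc : ∀ x y, d x (c x y) = y) (hidem : ∀ x, c x x = x) :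
    Nonempty (SteinerQuasigroup (S × Fin 3)) := by
  classical
  let up (x y : S) (i : Fin 3) : S × Fin 3 := if x = y then (x, i + 2) else (d x y, i)
  let op (a b : S × Fin 3) : S × Fin 3 :=
    if a.2 = b.2 then if a.1 = b.1 then a else (c a.1 b.1, a.2 + 1)
    else if b.2 = a.2 + 1 then up a.1 b.1 a.2 else up b.1 a.1 b.2
  refine ⟨⟨op, fun a => by simp [op], ?_, ?_⟩⟩
  · rintro ⟨x, i⟩ ⟨y, j⟩
    fin_cases i <;> fin_cases j <;> simp [op, up] <;> split_ifs <;> grind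
  · rintro ⟨x, i⟩ ⟨y, j⟩
    have := hidem x
    have := hidem y
    fin_cases i <;> fin_cases j <;> simp [op, up] <;> split_ifs <;> grind

/-- The Skolem construction, from a half-idempotent commutative quasigroup. -/
theorem nonempty_skolem {S : Type*} (c d : S → S → S) (low : S → Prop) (t : S → S)
    (hc : ∀ x y, c x y = c y x) (hcd : ∀ x y, c x (d x y) = y) (hdc : ∀ x y, d x (c x y) = y)
    (ht : ∀ x, t (t x) = x) (hlow : ∀ x, low (t x) ↔ ¬ low x)
    (hidem : ∀ x, low x → c x x = x) (hhalf : ∀ x, ¬ low x → c x x = t x) :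
    Nonempty (SteinerQuasigroup (Option (S × Fin 3))) := by
  classical
  let up (x y : S) (i : Fin 3) : Option (S × Fin 3) :=
    if c x x = y then if low x then some (x, i + 2) else none else some (d x y, i)
  let inf (a : S × Fin 3) : Option (S × Fin 3) :=
    some (t a.1, if low a.1 then a.2 + 2 else a.2 + 1)
  let op (a b : Option (S × Fin 3)) : Option (S × Fin 3) :=
    a.elim (b.elim none inf) fun a => b.elim (inf a) fun b =>
      if a.2 = b.2 then if a.1 = b.1 then some a else some (c a.1 b.1, a.2 + 1)
      else if b.2 = a.2 + 1 then up a.1 b.1 a.2 else up b.1 a.1 b.2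
  have trichotomy : ∀ i j : Fin 3, j = i ∨ j = i + 1 ∨ i = j + 1 := by decide
  have add_one_ne : ∀ i : Fin 3, i + 1 ≠ i := by decide
  have ne_add_two : ∀ i : Fin 3, i ≠ i + 1 + 1 := by decide
  have add_two : ∀ i : Fin 3, i + 2 + 1 = i := by decide
  have add_two' : ∀ i : Fin 3, i + 1 + 2 = i := by decide
  have add_four : ∀ i : Fin 3, i + 2 + 2 = i + 1 := by decide
  have add_one_one : ∀ i : Fin 3, i + 1 + 1 = i + 2 := by decide
  have op_none (x i) : op (some (x, i)) none = inf (x, i) := rfl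
  have none_op (x i) : op none (some (x, i)) = inf (x, i) := rfl
  have op_level {x y} (i) (h : x ≠ y) : op (some (x, i)) (some (y, i)) = some (c x y, i + 1) := by
    simp [op, h]
  have op_up (x y i) : op (some (x, i)) (some (y, i + 1)) = up x y i := by
    simp [op]
  have op_down (x y i) : op (some (y, i + 1)) (some (x, i)) = up x y i := by
    simp [op, add_one_ne, ne_add_two]
  have op_same (a) : op a a = a := by cases a <;> simp [op]
  have up_of_ne {x y} (i) (h : c x x ≠ y) : up x y i = some (d x y, i) := if_neg h
  have up_low {x} (i) (h : low x) : up x x i = some (x, i + 2) := by simp [up, h, hidem]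
  have up_high {x} (i) (h : ¬ low x) : up x (t x) i = none := by simp [up, h, hhalf]
  have inf_low {x} (i) (h : low x) : inf (x, i) = some (t x, i + 2) := by simp [inf, h]
  have inf_high {x} (i) (h : ¬ low x) : inf (x, i) = some (t x, i + 1) := by simp [inf, h]
  refine ⟨⟨op, op_same, ?_, ?_⟩⟩
  · rintro (_ | ⟨x, i⟩) (_ | ⟨y, j⟩) <;> try rfl
    obtain rfl | rfl | rfl := trichotomy i j
    · by_cases h : x = y
      · rw [h]
      · rw [op_level _ h, op_level _ (Ne.symm h), hc]
    · rw [op_up, op_down]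
    · rw [op_up, op_down]
  · rintro (_ | ⟨x, i⟩) (_ | ⟨y, j⟩)
    · rfl
    · rw [none_op]
      by_cases h : low y
      · rw [inf_low j h, none_op, inf_high _ (by simpa [hlow]), ht, add_two]
      · rw [inf_high j h, none_op, inf_low _ (by simpa [hlow]), ht, add_two']
    · rw [op_none]
      by_cases h : low x
      · have h' : ¬ low (t x) := by simpa [hlow]
        have := op_down (t x) x (i + 2)
        rw [add_two] at this
        have h2 := up_high (i + 2) h'
        rw [ht] at h2
        rw [inf_low i h, this, h2]
      · rw [inf_high i h, op_up, up_high i h]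
    · obtain rfl | rfl | rfl := trichotomy i j
      · by_cases h : x = y
        · rw [h, op_same, op_same]
        · have h' : c x x ≠ c x y := fun e => h (by rw [← hdc x x, e, hdc])
          rw [op_level _ h, op_up, up_of_ne _ h', hdc]
      · rw [op_up]
        by_cases h : c x x = y
        · by_cases hx : low x
          · rw [hidem x hx] at h
            subst h
            have := op_down x x (i + 2)
            rw [add_two] at this
            rw [up_low _ hx, this, up_low _ hx, add_four]
          · rw [hhalf x hx] at h
            subst h
            rw [up_high _ hx, op_none, inf_high _ hx]
        · have h' : x ≠ d x y := fun e => h (by conv_rhs => rw [← hcd x y, ← e])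
          rw [up_of_ne _ h, op_level _ h', hcd]
      · rw [op_down]
        by_cases h : c y y = x
        · by_cases hy : low y
          · rw [hidem y hy] at h
            subst h
            rw [up_low _ hy, ← add_one_one, op_up, up_low _ hy, add_two']
          · rw [hhalf y hy] at h
            subst h
            rw [up_high _ hy, op_none, inf_low _ (by simpa [hlow]), ht, add_two']
        · have e : c (d y x) y = x := by rw [hc, hcd]
          have e' : d (d y x) x = y := by simpa only [e] using hdc (d y x) y
          have h' : c (d y x) (d y x) ≠ x := fun e2 => h (by grind)
          rw [up_of_ne _ h, op_down, up_of_ne _ h', e']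

theorem nonempty_of_mod_six_eq_three {m : ℕ} (hm : m % 6 = 3) :
    Nonempty (SteinerQuasigroup (ZMod m)) := by
  obtain ⟨k, rfl⟩ : ∃ k, m = (2 * k + 1) * 3 := ⟨m / 6, by omega⟩
  have h2 : (2 : ZMod (2 * k + 1)) * (k + 1) = 1 := by
    have : ((2 * k + 1 : ℕ) : ZMod (2 * k + 1)) = 0 := ZMod.natCast_self _
    push_cast at this
    linear_combination this
  obtain ⟨s⟩ := nonempty_bose (S := ZMod (2 * k + 1)) (fun x y => (k + 1) * (x + y))
    (fun x y => 2 * y - x) (fun x y => by ring) (fun x y => by linear_combination y * h2)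
    (fun x y => by linear_combination (x + y) * h2) (fun x => by linear_combination x * h2)
  exact ⟨s.congr (Fintype.equivOfCardEq (by simp [ZMod.card]))⟩

theorem nonempty_of_mod_six_eq_one {m : ℕ} (hm : m % 6 = 1) :
    Nonempty (SteinerQuasigroup (ZMod m)) := by
  obtain ⟨k, rfl⟩ : ∃ k, m = 2 * k * 3 + 1 := ⟨m / 6, by omega⟩
  let half (n : ℕ) : ℕ := if n % 2 = 0 then n / 2 else n / 2 + k
  let double (n : ℕ) : ℕ := if n < k then 2 * n else 2 * (n - k) + 1
  have half_lt {n : ℕ} (hn : n < 2 * k) : half n < 2 * k := by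
    simp only [half]
    split_ifs <;> omega
  have double_lt {n : ℕ} (hn : n < 2 * k) : double n < 2 * k := by
    simp only [double]
    split_ifs <;> omega
  have half_double (n : ℕ) : half (double n) = n := by
    simp only [half, double]
    split_ifs <;> omega
  have double_half {n : ℕ} (hn : n < 2 * k) : double (half n) = n := by
    simp only [half, double]
    split_ifs <;> omega
  have mod_lt (x : Fin (2 * k)) (n : ℕ) : n % (2 * k) < 2 * k := Nat.mod_lt _ x.pos
  have mod_eq {n : ℕ} (hn : n < 4 * k) :
      n % (2 * k) = if n < 2 * k then n else n - 2 * k := by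
    split_ifs with h
    · exact Nat.mod_eq_of_lt h
    · rw [Nat.mod_eq_sub_mod (by omega), Nat.mod_eq_of_lt (by omega)]
  obtain ⟨s⟩ := nonempty_skolem (S := Fin (2 * k))
    (fun x y => ⟨half ((x + y) % (2 * k)), half_lt (mod_lt x _)⟩)
    (fun x y => ⟨(double y + (2 * k - x)) % (2 * k), mod_lt x _⟩)
    (fun x => x.val < k) (fun x => ⟨(x + k) % (2 * k), mod_lt x _⟩)
    (fun x y => by simp only [Nat.add_comm])
    (fun x y => Fin.ext <| by
      dsimp only
      rw [Nat.add_mod_mod, show x.val + (double y + (2 * k - x)) = double y + 2 * k by omega,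
        Nat.add_mod_right, Nat.mod_eq_of_lt (double_lt y.isLt), half_double])
    (fun x y => Fin.ext <| by
      dsimp only
      rw [double_half (mod_lt x _), Nat.mod_add_mod,
        show x.val + y + (2 * k - x) = y + 2 * k by omega, Nat.add_mod_right,
        Nat.mod_eq_of_lt y.isLt])
    (fun x => Fin.ext <| by
      dsimp only
      rw [Nat.mod_add_mod, show x.val + k + k = x + 2 * k by omega, Nat.add_mod_right,
        Nat.mod_eq_of_lt x.isLt])
    (fun x => by
      dsimp only
      rw [mod_eq (by omega)]
      split_ifs <;> omega)
    (fun x hx => Fin.ext <| by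
      dsimp only
      rw [Nat.mod_eq_of_lt (by omega)]
      simp only [half]
      split_ifs <;> omega)
    (fun x hx => Fin.ext <| by
      dsimp only
      rw [mod_eq (by omega), mod_eq (by omega)]
      simp only [half]
      split_ifs <;> omega)
  exact ⟨s.congr (Fintype.equivOfCardEq (by simp [ZMod.card]))⟩

end SteinerQuasigroup

namespace PartialIPLoop

variable {α : Type*} (P : PartialIPLoop α)

theorem inv_inv {x : α} (hx : x ∈ P.carrier) : P.inv (P.inv x) = x :=
  (P.inv_unique _ (P.inv_mem x hx) _ hx (P.inv_mul_dom x hx) (P.mul_inv_dom x hx)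
    (P.inv_mul x hx) (P.mul_inv x hx)).symm

theorem inv_one : P.inv P.one = P.one :=
  (P.inv_unique _ P.one_mem _ P.one_mem (P.one_mul_dom _ P.one_mem) (P.one_mul_dom _ P.one_mem)
    (P.one_mul _ P.one_mem) (P.one_mul _ P.one_mem)).symm

theorem inv_eq_one {x : α} (hx : x ∈ P.carrier) : P.inv x = P.one ↔ x = P.one :=
  ⟨fun h => by rw [← P.inv_inv hx, h, P.inv_one], fun h => h ▸ P.inv_one⟩

/-- The image of a partial IP loop under a map `f` with a left inverse `g` on the carrier. -/
def map {β : Type*} (f : α → β) (g : β → α) (hg : ∀ x ∈ P.carrier, g (f x) = x) :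
    PartialIPLoop β where
  carrier := f '' P.carrier
  one := f P.one
  dom := Prod.map f f '' P.dom
  mul x y := f (P.mul (g x) (g y))
  inv x := f (P.inv (g x))
  one_mem := ⟨_, P.one_mem, rfl⟩
  dom_subset := by
    rintro _ ⟨⟨x, y⟩, h, rfl⟩
    exact ⟨⟨x, (P.dom_subset h).1, rfl⟩, ⟨y, (P.dom_subset h).2, rfl⟩⟩
  mul_mem := by
    rintro _ _ ⟨⟨x, y⟩, h, ⟨⟩⟩
    rw [hg x (P.dom_subset h).1, hg y (P.dom_subset h).2]
    exact ⟨_, P.mul_mem x y h, rfl⟩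
  one_mul_dom := by
    rintro _ ⟨x, hx, rfl⟩
    exact ⟨_, P.one_mul_dom x hx, rfl⟩
  mul_one_dom := by
    rintro _ ⟨x, hx, rfl⟩
    exact ⟨_, P.mul_one_dom x hx, rfl⟩
  one_mul := by
    rintro _ ⟨x, hx, rfl⟩
    rw [hg _ P.one_mem, hg x hx, P.one_mul x hx]
  mul_one := by
    rintro _ ⟨x, hx, rfl⟩
    rw [hg _ P.one_mem, hg x hx, P.mul_one x hx]
  inv_mem := by
    rintro _ ⟨x, hx, rfl⟩
    rw [hg x hx]
    exact ⟨_, P.inv_mem x hx, rfl⟩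
  mul_inv_dom := by
    rintro _ ⟨x, hx, rfl⟩
    exact ⟨_, P.mul_inv_dom x hx, by simp [hg x hx]⟩
  inv_mul_dom := by
    rintro _ ⟨x, hx, rfl⟩
    exact ⟨_, P.inv_mul_dom x hx, by simp [hg x hx]⟩
  mul_inv := by
    rintro _ ⟨x, hx, rfl⟩
    rw [hg x hx, hg _ (P.inv_mem x hx), P.mul_inv x hx]
  inv_mul := by
    rintro _ ⟨x, hx, rfl⟩
    rw [hg x hx, hg _ (P.inv_mem x hx), P.inv_mul x hx]
  inv_unique := by
    have hinj : Set.InjOn f P.carrier := Set.LeftInvOn.injOn (f₁' := g) hg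
    rintro _ ⟨x, hx, rfl⟩ _ ⟨y, hy, rfl⟩ ⟨⟨x', y'⟩, h, hxy⟩ ⟨⟨y'', x''⟩, h', hyx⟩ e e'
    simp only [Prod.map_apply, Prod.mk.injEq] at hxy hyx
    obtain rfl := hinj (P.dom_subset h).1 hx hxy.1
    obtain rfl := hinj (P.dom_subset h).2 hy hxy.2
    obtain rfl := hinj (P.dom_subset h').1 hy hyx.1
    obtain rfl := hinj (P.dom_subset h').2 hx hyx.2
    rw [hg _ hx, hg _ hy] at e e'
    rw [hg _ hx, ← P.inv_unique _ hx _ hy h h' (hinj (P.mul_mem _ _ h) P.one_mem e)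
      (hinj (P.mul_mem _ _ h') P.one_mem e')]
  ip_left_dom := by
    rintro _ _ ⟨⟨x, y⟩, h, ⟨⟩⟩
    rw [hg x (P.dom_subset h).1, hg y (P.dom_subset h).2]
    exact ⟨_, P.ip_left_dom x y h, rfl⟩
  ip_right_dom := by
    rintro _ _ ⟨⟨x, y⟩, h, ⟨⟩⟩
    rw [hg x (P.dom_subset h).1, hg y (P.dom_subset h).2]
    exact ⟨_, P.ip_right_dom x y h, rfl⟩
  ip_left := by
    rintro _ _ ⟨⟨x, y⟩, h, ⟨⟩⟩
    have hx := (P.dom_subset h).1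
    rw [hg x hx, hg y (P.dom_subset h).2, hg _ (P.inv_mem x hx), hg _ (P.mul_mem x y h),
      P.ip_left x y h]
  ip_right := by
    rintro _ _ ⟨⟨x, y⟩, h, ⟨⟩⟩
    have hy := (P.dom_subset h).2
    rw [hg y hy, hg x (P.dom_subset h).1, hg _ (P.inv_mem y hy), hg _ (P.mul_mem x y h),
      P.ip_right x y h]

section Triplication

variable {G : Type*} [AddCommGroup G] (φ : α → G) (ψ : G → α) (s : SteinerQuasigroup G)

open Classical in
/-- The multiplication of the Steiner triplication; the new elements form two copies of `G`,
and `φ`, `ψ` identify the elements of `P` other than the unit with `G`. -/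
noncomputable def tripleMul : α ⊕ (G × Bool) → α ⊕ (G × Bool) → α ⊕ (G × Bool)
  | .inl x, .inl y => .inl (P.mul x y)
  | .inl x, .inr (y, false) => if x = P.one then .inr (y, false) else .inr (φ x + y, true)
  | .inl x, .inr (y, true) => if x = P.one then .inr (y, true) else .inr (y - φ (P.inv x), false)
  | .inr (y, false), .inl x =>
    if x = P.one then .inr (y, false) else .inr (φ (P.inv x) + y, true)
  | .inr (y, true), .inl x => if x = P.one then .inr (y, true) else .inr (y - φ x, false)
  | .inr (y, false), .inr (z, true) => .inl (P.inv (ψ (z - y)))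
  | .inr (z, true), .inr (y, false) => .inl (ψ (z - y))
  | .inr (y, false), .inr (z, false) => if y = z then .inl P.one else .inr (s.op y z, false)
  | .inr (y, true), .inr (z, true) => if y = z then .inl P.one else .inr (s.op y z, true)

/-- The carrier of the Steiner triplication. -/
def tripleCarrier (G : Type*) : Set (α ⊕ (G × Bool)) :=
  {x | ∀ a, x = .inl a → a ∈ P.carrier}

/-- The domain of the multiplication of the Steiner triplication. -/
def tripleDom (G : Type*) : Set ((α ⊕ (G × Bool)) × (α ⊕ (G × Bool))) :=
  {p | p.1 ∈ P.tripleCarrier G ∧ p.2 ∈ P.tripleCarrier G ∧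
    ∀ a b, p = (.inl a, .inl b) → (a, b) ∈ P.dom}

/-- The Steiner triplication of a partial IP loop. -/
noncomputable def triple (hφ : ∀ g, φ (ψ g) = g)
    (hψ : ∀ x ∈ P.carrier, x ≠ P.one → ψ (φ x) = x)
    (hmem : ∀ g, ψ g ∈ P.carrier) (hne : ∀ g, ψ g ≠ P.one) :
    PartialIPLoop (α ⊕ (G × Bool)) where
  carrier := P.tripleCarrier G
  one := .inl P.one
  dom := P.tripleDom G
  mul := P.tripleMul φ ψ s
  inv := Sum.map P.inv id
  one_mem := by simp [tripleCarrier, P.one_mem]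
  dom_subset := fun p hp => ⟨hp.1, hp.2.1⟩
  mul_mem := by
    rintro (x | ⟨x, _ | _⟩) (y | ⟨y, _ | _⟩) ⟨hx, hy, h⟩ <;>
      simp [tripleMul, tripleCarrier] at * <;>
      grind [P.one_mem, P.inv_mem, P.mul_mem]
  one_mul_dom := by
    rintro (x | ⟨x, _ | _⟩) <;> simp [tripleDom, tripleCarrier, P.one_mem]
    grind [P.one_mul_dom]
  mul_one_dom := by
    rintro (x | ⟨x, _ | _⟩) <;> simp [tripleDom, tripleCarrier, P.one_mem]
    grind [P.mul_one_dom]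
  one_mul := by
    rintro (x | ⟨x, _ | _⟩) <;> simp [tripleMul, tripleCarrier]
    grind [P.one_mul]
  mul_one := by
    rintro (x | ⟨x, _ | _⟩) <;> simp [tripleMul, tripleCarrier]
    grind [P.mul_one]
  inv_mem := by
    rintro (x | ⟨x, _ | _⟩) <;> simp [tripleCarrier]
    grind [P.inv_mem]
  mul_inv_dom := by
    rintro (x | ⟨x, _ | _⟩) <;> simp [tripleDom, tripleCarrier]
    grind [P.mul_inv_dom, P.inv_mem]
  inv_mul_dom := by
    rintro (x | ⟨x, _ | _⟩) <;> simp [tripleDom, tripleCarrier]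
    grind [P.inv_mul_dom, P.inv_mem]
  mul_inv := by
    rintro (x | ⟨x, _ | _⟩) <;> simp [tripleMul, tripleCarrier]
    grind [P.mul_inv]
  inv_mul := by
    rintro (x | ⟨x, _ | _⟩) <;> simp [tripleMul, tripleCarrier]
    grind [P.inv_mul]
  inv_unique := by
    rintro (x | ⟨x, _ | _⟩) hx (y | ⟨y, _ | _⟩) hy ⟨-, -, h⟩ ⟨-, -, h'⟩ <;>
      simp [tripleMul, tripleCarrier] at * <;> grind [P.inv_unique, P.inv_eq_one]
  ip_left_dom := by
    rintro (x | ⟨x, _ | _⟩) (y | ⟨y, _ | _⟩) ⟨hx, hy, h⟩ <;>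
      simp [tripleMul, tripleCarrier, tripleDom] at * <;>
      grind [P.one_mem, P.inv_mem, P.mul_mem, P.ip_left_dom, P.one_mul_dom, P.mul_one_dom]
  ip_right_dom := by
    rintro (x | ⟨x, _ | _⟩) (y | ⟨y, _ | _⟩) ⟨hx, hy, h⟩ <;>
      simp [tripleMul, tripleCarrier, tripleDom] at * <;>
      grind [P.one_mem, P.inv_mem, P.mul_mem, P.ip_right_dom, P.one_mul_dom, P.mul_one_dom]
  ip_left := by
    have op_ne {y z : G} (h : y ≠ z) : y ≠ s.op y z := fun e => h (by
      rw [← s.op_op y z, ← e, s.op_self])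
    rintro (x | ⟨x, _ | _⟩) (y | ⟨y, _ | _⟩) ⟨hx, hy, h⟩
    · simp [tripleMul, P.ip_left x y (h x y rfl)]
    · have hx : x ∈ P.carrier := hx x rfl
      by_cases hx1 : x = P.one <;> simp [tripleMul, hx1, P.inv_one, P.inv_eq_one hx, P.inv_inv hx]
    · have hx : x ∈ P.carrier := hx x rfl
      by_cases hx1 : x = P.one <;> simp [tripleMul, hx1, P.inv_one, P.inv_eq_one hx]
    · have hy : y ∈ P.carrier := hy y rfl
      by_cases hy1 : y = P.one
      · simp [tripleMul, hy1]
      · simp [tripleMul, hy1, hψ _ (P.inv_mem y hy), P.inv_eq_one hy, P.inv_inv hy]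
    · by_cases hxy : x = y
      · simp [tripleMul, hxy]
      · simp [tripleMul, hxy, op_ne hxy, s.op_op]
    · simp [tripleMul, P.inv_eq_one, P.inv_inv, hmem, hne, hφ]
    · have hy : y ∈ P.carrier := hy y rfl
      by_cases hy1 : y = P.one
      · simp [tripleMul, hy1]
      · simp [tripleMul, hy1, hψ y hy]
    · simp [tripleMul, hne, hφ]
    · by_cases hxy : x = y
      · simp [tripleMul, hxy]
      · simp [tripleMul, hxy, op_ne hxy, s.op_op]
  ip_right := by
    have op_op {y z : G} : s.op (s.op y z) z = y := by
      rw [s.op_comm y, s.op_comm, s.op_op]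
    have op_ne {y z : G} (h : y ≠ z) : s.op y z ≠ z := fun e => h (by
      rw [← op_op (y := y) (z := z), e, s.op_self])
    rintro (x | ⟨x, _ | _⟩) (y | ⟨y, _ | _⟩) ⟨hx, hy, h⟩
    · simp [tripleMul, P.ip_right x y (h x y rfl)]
    · have hx : x ∈ P.carrier := hx x rfl
      by_cases hx1 : x = P.one
      · simp [tripleMul, hx1]
      · simp [tripleMul, hx1, hψ x hx]
    · have hx : x ∈ P.carrier := hx x rfl
      by_cases hx1 : x = P.one
      · simp [tripleMul, hx1]
      · simp [tripleMul, hx1, hψ _ (P.inv_mem x hx), P.inv_eq_one hx, P.inv_inv hx]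
    · have hy : y ∈ P.carrier := hy y rfl
      by_cases hy1 : y = P.one <;> simp [tripleMul, hy1, P.inv_one, P.inv_eq_one hy]
    · by_cases hxy : x = y
      · simp [tripleMul, hxy]
      · simp [tripleMul, hxy, op_ne hxy, op_op]
    · simp [tripleMul, P.inv_eq_one, P.inv_inv, hmem, hne, hφ]
    · have hy : y ∈ P.carrier := hy y rfl
      by_cases hy1 : y = P.one <;> simp [tripleMul, hy1, P.inv_one, P.inv_eq_one hy, P.inv_inv hy]
    · simp [tripleMul, hne, hφ]
    · by_cases hxy : x = y
      · simp [tripleMul, hxy]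
      · simp [tripleMul, hxy, op_ne hxy, op_op]

variable {φ ψ s} {hφ : ∀ g, φ (ψ g) = g} {hψ : ∀ x ∈ P.carrier, x ≠ P.one → ψ (φ x) = x}
  {hmem : ∀ g, ψ g ∈ P.carrier} {hne : ∀ g, ψ g ≠ P.one}

theorem tripleCarrier_eq :
    P.tripleCarrier G = Sum.inl '' P.carrier ∪ Sum.inr '' Set.univ := by
  ext (x | x) <;> simp [tripleCarrier]

theorem gaps_triple : (P.triple φ ψ s hφ hψ hmem hne).gaps = Prod.map Sum.inl Sum.inl '' P.gaps := by
  ext ⟨x | x, y | y⟩ <;> simp [gaps, triple, tripleDom, tripleCarrier]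
  tauto

end Triplication

theorem gaps_map {β : Type*} (f : α → β) (g : β → α) (hg : ∀ x ∈ P.carrier, g (f x) = x) :
    (P.map f g hg).gaps = Prod.map f f '' P.gaps := by
  have hinj : Set.InjOn f P.carrier := Set.LeftInvOn.injOn (f₁' := g) hg
  have hinj' : Set.InjOn (Prod.map f f) (P.carrier ×ˢ P.carrier) := hinj.prodMap hinj
  simp only [gaps, map]
  rw [hinj'.image_sdiff_subset P.dom_subset, Set.prodMap_image_prod]

end PartialIPLoop

/-- Steiner triplication: if `P` is a finite partial IP loop with `#P ≡ 2` or
`#P ≡ 4 (mod 6)`, then there is a finite partial IP loop `Q` extending `P` with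
`#Q = 3·#P − 2`, with `Γ(Q) = Γ(P)` (so every pair involving a new element lies
in `D(Q)`), and with every element of `Q \ P` of order two. -/
theorem exists_steiner_triplication {α : Type*} [Infinite α]
    (P : PartialIPLoop α) (hP : P.carrier.Finite)
    (hmod : P.carrier.ncard % 6 = 2 ∨ P.carrier.ncard % 6 = 4) :
    ∃ Q : PartialIPLoop α, Q.carrier.Finite ∧ P.Ext Q ∧
      Q.carrier.ncard = 3 * P.carrier.ncard - 2 ∧
      Q.gaps = P.gaps ∧
      Q.carrier \ P.carrier ⊆ Q.O2 := by
  obtain ⟨m, hm⟩ : ∃ m, P.carrier.ncard = m + 1 := ⟨P.carrier.ncard - 1, by omega⟩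
  have : NeZero m := ⟨by omega⟩
  obtain ⟨s⟩ : Nonempty (SteinerQuasigroup (ZMod m)) := by
    obtain h | h : m % 6 = 1 ∨ m % 6 = 3 := by omega
    · exact SteinerQuasigroup.nonempty_of_mod_six_eq_one h
    · exact SteinerQuasigroup.nonempty_of_mod_six_eq_three h
  let X : Set α := P.carrier \ {P.one}
  have hX : X.ncard = m := by rw [Set.ncard_sdiff_singleton_of_mem P.one_mem, hm]; rfl
  have : Finite X := hP.subset Set.sdiff_subset
  obtain ⟨e⟩ : Nonempty (ZMod m ≃ X) :=
    Finite.card_eq.1 (by rw [Nat.card_zmod, Nat.card_coe_set_eq, hX])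
  let ψ (g : ZMod m) : α := e g
  have hψinj : Function.Injective ψ := Subtype.val_injective.comp e.injective
  let φ : α → ZMod m := Function.invFun ψ
  have hφ (g) : φ (ψ g) = g := Function.leftInverse_invFun hψinj g
  have hmem (g) : ψ g ∈ P.carrier := (e g).2.1
  have hne (g) : ψ g ≠ P.one := (e g).2.2
  have hψ (x) (hx : x ∈ P.carrier) (hx1 : x ≠ P.one) : ψ (φ x) = x :=
    Function.invFun_eq ⟨e.symm ⟨x, hx, hx1⟩, by simp [ψ]⟩
  let R := P.triple φ ψ s hφ hψ hmem hne
  have : Infinite ↥P.carrierᶜ := hP.infinite_compl.to_subtype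
  let ι : ZMod m × Bool → α := fun a =>
    (Infinite.natEmbedding ↥P.carrierᶜ).trans (Function.Embedding.subtype _)
      (Finite.equivFin (ZMod m × Bool) a)
  have hι : Function.Injective ι := (Function.Embedding.injective _).comp
    (Fin.val_injective.comp (Equiv.injective _))
  have hιP (a) : ι a ∉ P.carrier := (Infinite.natEmbedding ↥P.carrierᶜ _).2
  let f : α ⊕ (ZMod m × Bool) → α := Sum.elim id ι
  have hf : Set.InjOn f (P.tripleCarrier (ZMod m)) := by
    rintro (x | x) hx (y | y) hy h
    · exact congrArg _ h
    · exact absurd (hx x rfl) ((show x = ι y from h) ▸ hιP y)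
    · exact absurd (hy y rfl) ((show ι x = y from h) ▸ hιP x)
    · exact congrArg _ (hι h)
  let g := Function.invFunOn f (P.tripleCarrier (ZMod m))
  have hg : ∀ x ∈ R.carrier, g (f x) = x := hf.leftInvOn_invFunOn
  have hgl (x) (hx : x ∈ P.carrier) : g x = .inl x := hg (.inl x) (by rintro _ ⟨⟩; exact hx)
  have hgr (a) : g (ι a) = .inr a := hg (.inr a) (by rintro _ ⟨⟩)
  let Q := R.map f g hg
  have hcarrier : Q.carrier = P.carrier ∪ Set.range ι := by
    change f '' P.tripleCarrier (ZMod m) = _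
    rw [PartialIPLoop.tripleCarrier_eq, Set.image_union, Set.image_image, Set.image_image, Set.image_univ]
    simp [f]
  refine ⟨Q, ?_, ⟨?_, ?_, ?_⟩, ?_, ?_, ?_⟩
  · rw [hcarrier]
    exact hP.union (Set.finite_range ι)
  · rw [hcarrier]
    exact Set.subset_union_left
  · rintro ⟨x, y⟩ h
    have h' := P.dom_subset h
    refine ⟨(.inl x, .inl y), ⟨?_, ?_, ?_⟩, rfl⟩
    · rintro _ ⟨⟩; exact h'.1
    · rintro _ ⟨⟩; exact h'.2
    · rintro _ _ ⟨⟩; exact h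
  · intro x y h
    have h' := P.dom_subset h
    change _ = f (P.tripleMul φ ψ s (g x) (g y))
    rw [hgl x h'.1, hgl y h'.2]
    rfl
  · rw [hcarrier, Set.ncard_union_eq (Set.disjoint_right.2 (by rintro _ ⟨a, rfl⟩; exact hιP a)) hP,
      ← Set.image_univ, Set.ncard_image_of_injective _ hι, Set.ncard_univ, Nat.card_prod,
      Nat.card_zmod, hm]
    simp
    omega
  · rw [PartialIPLoop.gaps_map, PartialIPLoop.gaps_triple, Set.image_image]
    simp [f, Prod.map]
  · rintro x ⟨hx, hxP⟩
    obtain ⟨a, rfl⟩ : x ∈ Set.range ι := (hcarrier ▸ hx).resolve_left hxP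
    have ha : Sum.inr a ∈ P.tripleCarrier (ZMod m) := by rintro _ ⟨⟩
    refine ⟨hx, fun h => hxP (h ▸ P.one_mem), ⟨(.inr a, .inr a), ⟨ha, ha, ?_⟩, rfl⟩, ?_⟩
    · rintro _ _ ⟨⟩
    · change f (P.tripleMul φ ψ s (g (ι a)) (g (ι a))) = f (.inl P.one)
      rw [hgr]
      obtain ⟨a, _ | _⟩ := a <;> simp [PartialIPLoop.tripleMul]
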